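/- Let ν > −1. The function f_ν : Δ_ν → ℝ defined by f_ν(x) = d_ν'(x)/d_ν(x) − ν/x satisfies f_ν'(x) = −2∑_{n≥1} (α_{ν,n}² + x²)/(α_{ν,n}² − x²)² < 0 for all x ∈ Δ_ν; in particular f_ν is strictly decreasing on each component interval of Δ_ν. -/

import Mathlib

open Real Filter Set

/-- The Bessel function of the first kind of order `ν`, defined by its power series. -/
noncomputable def besselJ (ν x : ℝ) : ℝ :=
  ∑' n : ℕ, (-1 : ℝ) ^ n * x ^ (2 * (n : ℝ) + ν) /
    (2 ^ (2 * (n : ℝ) + ν) * (n.factorial : ℝ) * Real.Gamma ((n : ℝ) + ν + 1))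

/-- The Dini function `d_ν(x) = (1-ν) J_ν(x) + x J_ν'(x) = J_ν(x) - x J_{ν+1}(x)`. -/
noncomputable def dini (ν x : ℝ) : ℝ :=
  besselJ ν x - x * besselJ (ν + 1) x

/-- The coefficients of the entire function `w ↦ (√w / 2) ^ (-ν) * J_ν(√w)`. -/
noncomputable def besselCoeff (ν : ℝ) (n : ℕ) : ℝ :=
  (-1 / 4) ^ n / ((n.factorial : ℝ) * Real.Gamma ((n : ℝ) + ν + 1))

/-- The entire function `E_ν` with `J_ν(x) = (x / 2) ^ ν * E_ν(x ^ 2)`. -/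
noncomputable def besselEntire (ν : ℝ) (w : ℂ) : ℂ :=
  ∑' n : ℕ, (besselCoeff ν n : ℂ) * w ^ n

theorem besselCoeff_succ_mul (ν : ℝ) (n : ℕ) :
    besselCoeff ν (n + 1) * (n + 1) = -1 / 4 * besselCoeff (ν + 1) n := by
  have h1 : ((n : ℝ) + 1) ≠ 0 := by positivity
  have h2 : ((n : ℝ) + 1 + ν + 1) = (n : ℝ) + (ν + 1) + 1 := by ring
  simp only [besselCoeff, Nat.factorial_succ, Nat.cast_mul, Nat.cast_succ, h2, pow_succ]
  rw [show ((n : ℝ) + 1) * (n.factorial : ℝ) * Gamma ((n : ℝ) + (ν + 1) + 1)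
    = (n.factorial : ℝ) * Gamma ((n : ℝ) + (ν + 1) + 1) * (n + 1) by ring, div_mul_eq_mul_div,
    mul_div_mul_right _ _ h1]
  ring

theorem besselCoeff_zero (ν : ℝ) : besselCoeff ν 0 = 1 / Real.Gamma (ν + 1) := by
  simp [besselCoeff]

theorem add_mul_besselCoeff_add_one {ν : ℝ} (hν : -1 < ν) (n : ℕ) :
    (n + ν + 1) * besselCoeff (ν + 1) n = besselCoeff ν n := by
  have h1 : (0 : ℝ) < n + ν + 1 := by
    have : (0 : ℝ) ≤ n := n.cast_nonneg
    linarith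
  have h2 := (Real.Gamma_pos_of_pos h1).ne'
  have h3 : (n : ℝ) + (ν + 1) + 1 = (n + ν + 1) + 1 := by ring
  simp only [besselCoeff]
  rw [h3, Real.Gamma_add_one h1.ne']
  have h4 : (n.factorial : ℝ) ≠ 0 := by positivity
  have h5 := h1.ne'
  field_simp

theorem exists_abs_besselCoeff_le {ν : ℝ} (hν : -1 < ν) :
    ∃ C K : ℝ, 0 < C ∧ 0 < K ∧ ∀ n, |besselCoeff ν n| ≤ C * (K ^ n / ((2 * n).factorial : ℝ)) := by
  have hν' : 0 < ν + 1 := by linarith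
  set δ := min 1 (ν + 1) with hδ
  have hδ0 : 0 < δ := lt_min one_pos hν'
  have hΓ := Real.Gamma_pos_of_pos hν'
  refine ⟨1 / Real.Gamma (ν + 1), 1 / δ, by positivity, by positivity, fun n => ?_⟩
  induction n with
  | zero => simp [besselCoeff_zero, abs_of_pos hΓ]
  | succ n ih =>
    have hn : (0 : ℝ) ≤ n := n.cast_nonneg
    have h1 : δ * (n + 1) ≤ n + ν + 1 := by
      have h2 : δ ≤ 1 := min_le_left _ _
      have h3 : δ ≤ ν + 1 := min_le_right _ _
      nlinarith
    have h0 : 0 < (n : ℝ) + ν + 1 := lt_of_lt_of_le (by positivity) h1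
    have e : besselCoeff ν (n + 1) = -1 / 4 * besselCoeff ν n / ((n + 1) * (n + ν + 1)) := by
      rw [eq_div_iff (by positivity), ← add_mul_besselCoeff_add_one hν n]
      linear_combination (n + ν + 1) * besselCoeff_succ_mul ν n
    have hf : (((2 * (n + 1)).factorial : ℕ) : ℝ)
        = (2 * n + 2) * (2 * n + 1) * ((2 * n).factorial : ℝ) := by
      rw [show 2 * (n + 1) = (2 * n + 1) + 1 by ring, Nat.factorial_succ, Nat.factorial_succ]
      push_cast
      ring
    rw [e, abs_div, abs_mul, abs_of_pos (show (0 : ℝ) < (n + 1) * (n + ν + 1) by positivity),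
      div_le_iff₀ (by positivity), hf]
    have h4 : |(-1 / 4 : ℝ)| = 1 / 4 := by norm_num [abs_div]
    rw [h4]
    calc 1 / 4 * |besselCoeff ν n|
        ≤ 1 / 4 * (1 / Real.Gamma (ν + 1) * ((1 / δ) ^ n / ((2 * n).factorial : ℝ))) := by gcongr
      _ ≤ 1 / Real.Gamma (ν + 1) * ((1 / δ) ^ n / ((2 * n).factorial : ℝ)) *
          (1 / δ * ((n + 1) * (δ * (n + 1))) / ((2 * n + 2) * (2 * n + 1))) := by
        rw [mul_comm (1 / 4 : ℝ)]
        refine mul_le_mul_of_nonneg_left ?_ (by positivity)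
        rw [show 1 / δ * (((n : ℝ) + 1) * (δ * (n + 1))) = (n + 1) * (n + 1) by field_simp,
          div_le_div_iff₀ (by positivity) (by positivity)]
        nlinarith
      _ ≤ 1 / Real.Gamma (ν + 1) * ((1 / δ) ^ n / ((2 * n).factorial : ℝ)) *
          (1 / δ * ((n + 1) * (n + ν + 1)) / ((2 * n + 2) * (2 * n + 1))) := by gcongr
      _ = _ := by
        rw [pow_succ]
        field_simp

theorem hasSum_majorant (C : ℝ) {K r : ℝ} (hK : 0 ≤ K) (hr : 0 ≤ r) :
    HasSum (fun n : ℕ => C * (K ^ n / ((2 * n).factorial : ℝ)) * r ^ n)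
      (C * Real.cosh (√(K * r))) := by
  have h := (Real.hasSum_cosh √(K * r)).mul_left C
  refine h.congr_fun fun n => ?_
  rw [pow_mul, Real.sq_sqrt (by positivity), mul_pow]
  ring

theorem summable_norm_besselEntire {ν : ℝ} (hν : -1 < ν) (r : ℝ) :
    Summable fun n => |besselCoeff ν n| * |r| ^ n := by
  obtain ⟨C, K, hC, hK, hb⟩ := exists_abs_besselCoeff_le hν
  refine (hasSum_majorant C hK.le (abs_nonneg r)).summable.of_nonneg_of_le (fun n => by positivity)
    fun n => ?_
  gcongr
  exact hb n

theorem summable_besselEntire {ν : ℝ} (hν : -1 < ν) (w : ℂ) :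
    Summable fun n => (besselCoeff ν n : ℂ) * w ^ n := by
  refine Summable.of_norm ?_
  simpa using summable_norm_besselEntire hν ‖w‖

theorem exists_norm_besselEntire_le {ν : ℝ} (hν : -1 < ν) :
    ∃ C k : ℝ, 0 < C ∧ 0 ≤ k ∧ ∀ w, ‖besselEntire ν w‖ ≤ C * Real.exp (k * √‖w‖) := by
  obtain ⟨C, K, hC, hK, hb⟩ := exists_abs_besselCoeff_le hν
  refine ⟨C, √K, hC, Real.sqrt_nonneg K, fun w => ?_⟩
  refine (tsum_of_norm_bounded (hasSum_majorant C hK.le (norm_nonneg w)) fun n => ?_).trans ?_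
  · rw [norm_mul, norm_pow, Complex.norm_real, Real.norm_eq_abs]
    gcongr
    exact hb n
  · rw [Real.sqrt_mul hK.le]
    gcongr
    rw [Real.cosh_eq]
    have : Real.exp (-(√K * √‖w‖)) ≤ Real.exp (√K * √‖w‖) :=
      Real.exp_le_exp.mpr (by have : 0 ≤ √K * √‖w‖ := by positivity
                              linarith)
    linarith

theorem hasDerivAt_besselEntire {ν : ℝ} (hν : -1 < ν) (w : ℂ) :
    HasDerivAt (besselEntire ν) (-1 / 4 * besselEntire (ν + 1) w) w := by
  set r := ‖w‖ + 1 with hr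
  have hr0 : 0 < r := by positivity
  have hw : w ∈ Metric.ball (0 : ℂ) r := by rw [mem_ball_zero_iff]; linarith
  have hsum := summable_norm_besselEntire hν r
  have hF : ∀ n : ℕ, DifferentiableOn ℂ (fun z : ℂ => (besselCoeff ν n : ℂ) * z ^ n)
      (Metric.ball 0 r) := fun n => by fun_prop
  have hle : ∀ (n : ℕ) (z : ℂ), z ∈ Metric.ball (0 : ℂ) r →
      ‖(besselCoeff ν n : ℂ) * z ^ n‖ ≤ |besselCoeff ν n| * |r| ^ n := by
    intro n z hz
    rw [norm_mul, norm_pow, Complex.norm_real, Real.norm_eq_abs, abs_of_pos hr0]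
    gcongr
    exact (mem_ball_zero_iff.mp hz).le
  have h1 := Complex.hasSum_deriv_of_summable_norm hsum hF Metric.isOpen_ball hle hw
  have h2 : DifferentiableAt ℂ (besselEntire ν) w :=
    (Complex.differentiableOn_tsum_of_summable_norm hsum hF Metric.isOpen_ball hle).differentiableAt
      (Metric.isOpen_ball.mem_nhds hw)
  refine h2.hasDerivAt.congr_deriv ?_
  have h3 := (hasSum_nat_add_iff' 1).mpr h1
  simp only [Finset.range_one, Finset.sum_singleton, pow_zero, mul_one, deriv_const, sub_zero] at h3
  refine h3.unique ((((summable_besselEntire (by linarith : -1 < ν + 1) w).hasSum).mul_left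
    (-1 / 4 : ℂ)).congr_fun fun n => ?_)
  have h4 := congrArg (fun x : ℝ => (x : ℂ)) (besselCoeff_succ_mul ν n)
  push_cast at h4
  rw [deriv_const_mul_field, deriv_pow_field]
  push_cast
  linear_combination w ^ n * h4

theorem differentiable_besselEntire {ν : ℝ} (hν : -1 < ν) : Differentiable ℂ (besselEntire ν) :=
  fun w => (hasDerivAt_besselEntire hν w).differentiableAt

theorem besselEntire_recurrence {ν : ℝ} (hν : -1 < ν) (w : ℂ) :
    besselEntire ν w = (ν + 1) * besselEntire (ν + 1) w - w / 4 * besselEntire (ν + 2) w := by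
  have h1 := (summable_besselEntire (by linarith : -1 < ν + 1) w).hasSum.mul_left ((ν : ℂ) + 1)
  have h2 := (summable_besselEntire (by linarith : -1 < ν + 2) w).hasSum.mul_left (w / 4)
  have h3 := (summable_besselEntire hν w).hasSum
  have h4 := (h3.sub h1)
  have h5 := (hasSum_nat_add_iff' 1).mpr h4
  have h6 : (∑' n, (besselCoeff ν n : ℂ) * w ^ n)
      - (ν + 1) * ∑' n, (besselCoeff (ν + 1) n : ℂ) * w ^ n
      = -(w / 4 * ∑' n, (besselCoeff (ν + 2) n : ℂ) * w ^ n) := by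
    have h0 := congrArg (fun x : ℝ => (x : ℂ)) (add_mul_besselCoeff_add_one hν 0)
    push_cast at h0
    simp only [Finset.range_one, Finset.sum_singleton, pow_zero, mul_one] at h5
    rw [show (besselCoeff ν 0 : ℂ) - (ν + 1) * besselCoeff (ν + 1) 0 = 0 by
      linear_combination -h0, sub_zero] at h5
    refine h5.unique (h2.neg.congr_fun fun n => ?_)
    have h7 := congrArg (fun x : ℝ => (x : ℂ)) (add_mul_besselCoeff_add_one hν (n + 1))
    have h8 := congrArg (fun x : ℝ => (x : ℂ)) (besselCoeff_succ_mul (ν + 1) n)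
    rw [show ν + 1 + 1 = ν + 2 by ring] at h8
    push_cast at h7 h8
    rw [← h7, pow_succ]
    linear_combination w ^ n * w * h8
  simp only [besselEntire]
  linear_combination h6

theorem besselEntire_zero_ne {ν : ℝ} (hν : -1 < ν) : besselEntire ν 0 ≠ 0 := by
  have : besselEntire ν 0 = besselCoeff ν 0 := by
    rw [besselEntire, tsum_eq_single 0 fun n hn => by simp [hn]]
    simp
  rw [this, besselCoeff_zero]
  have := (Real.Gamma_pos_of_pos (by linarith : 0 < ν + 1)).ne'
  exact_mod_cast one_div_ne_zero this

theorem besselEntire_ofReal (ν x : ℝ) :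
    besselEntire ν x = ((∑' n : ℕ, besselCoeff ν n * x ^ n : ℝ) : ℂ) := by
  rw [besselEntire, Complex.ofReal_tsum]
  simp

theorem ofReal_re_besselEntire (ν x : ℝ) :
    ((besselEntire ν x).re : ℂ) = besselEntire ν x := by
  rw [besselEntire_ofReal, Complex.ofReal_re]

theorem besselJ_eq {x : ℝ} (hx : 0 < x) (ν : ℝ) :
    besselJ ν x = (x / 2) ^ ν * (besselEntire ν ((x ^ 2 : ℝ) : ℂ)).re := by
  rw [besselEntire_ofReal, Complex.ofReal_re, ← tsum_mul_left, besselJ]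
  refine tsum_congr fun n => ?_
  rw [Real.rpow_add hx, Real.rpow_add two_pos, Real.div_rpow hx.le two_pos.le, besselCoeff,
    show (2 * (n : ℝ)) = ((2 * n : ℕ) : ℝ) by push_cast; ring, Real.rpow_natCast,
    Real.rpow_natCast, pow_mul 2 2 n, div_pow, pow_mul]
  norm_num
  rw [div_eq_mul_inv, div_eq_mul_inv, div_eq_mul_inv, div_eq_mul_inv]
  simp only [mul_inv]
  ring

/-- The entire function `D_ν` with `d_ν(x) = (x / 2) ^ ν * D_ν(x ^ 2)`. -/
noncomputable def diniEntire (ν : ℝ) (w : ℂ) : ℂ :=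
  besselEntire ν w - w / 2 * besselEntire (ν + 1) w

theorem ofReal_re_diniEntire (ν x : ℝ) : ((diniEntire ν x).re : ℂ) = diniEntire ν x := by
  have h : diniEntire ν x
      = (((besselEntire ν x).re - x / 2 * (besselEntire (ν + 1) x).re : ℝ) : ℂ) := by
    push_cast
    rw [ofReal_re_besselEntire, ofReal_re_besselEntire, diniEntire]
  rw [h, Complex.ofReal_re]

theorem dini_eq {x : ℝ} (hx : 0 < x) (ν : ℝ) :
    dini ν x = (x / 2) ^ ν * (diniEntire ν ((x ^ 2 : ℝ) : ℂ)).re := by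
  have h : (diniEntire ν ((x ^ 2 : ℝ) : ℂ)).re = (besselEntire ν ((x ^ 2 : ℝ) : ℂ)).re
      - x ^ 2 / 2 * (besselEntire (ν + 1) ((x ^ 2 : ℝ) : ℂ)).re := by
    rw [diniEntire, Complex.sub_re, ← ofReal_re_besselEntire (ν + 1) (x ^ 2),
      show ((x ^ 2 : ℝ) : ℂ) / 2 = ((x ^ 2 / 2 : ℝ) : ℂ) by push_cast; ring,
      ← Complex.ofReal_mul, Complex.ofReal_re, Complex.ofReal_re]
  rw [dini, besselJ_eq hx, besselJ_eq hx, h, Real.rpow_add (by positivity), Real.rpow_one]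
  ring

theorem hasDerivAt_diniEntire {ν : ℝ} (hν : -1 < ν) (w : ℂ) :
    HasDerivAt (diniEntire ν) (-3 / 4 * besselEntire (ν + 1) w
      + w / 8 * besselEntire (ν + 2) w) w := by
  have h1 := hasDerivAt_besselEntire hν w
  have h2 := hasDerivAt_besselEntire (by linarith : -1 < ν + 1) w
  rw [show ν + 1 + 1 = ν + 2 by ring] at h2
  refine (h1.sub (((hasDerivAt_id' w).div_const 2).mul h2)).congr_deriv ?_
  ring

theorem diniEntire_zero_ne {ν : ℝ} (hν : -1 < ν) : diniEntire ν 0 ≠ 0 := by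
  simpa [diniEntire] using besselEntire_zero_ne hν

theorem exists_norm_diniEntire_le {ν : ℝ} (hν : -1 < ν) :
    ∃ C c : ℝ, 0 ≤ c ∧ ∀ w, ‖diniEntire ν w‖ ≤ C * Real.exp (c * √‖w‖) := by
  obtain ⟨C₀, k₀, hC₀, hk₀, h₀⟩ := exists_norm_besselEntire_le hν
  obtain ⟨C₁, k₁, hC₁, hk₁, h₁⟩ := exists_norm_besselEntire_le (by linarith : -1 < ν + 1)
  refine ⟨C₀ + C₁, k₀ + k₁ + 1, by positivity, fun w => ?_⟩
  set s := √‖w‖ with hs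
  have hs0 : 0 ≤ s := Real.sqrt_nonneg _
  have hsq : ‖w / 2‖ = s ^ 2 / 2 := by rw [norm_div, hs, Real.sq_sqrt (norm_nonneg w)]; simp
  have hexp : s ^ 2 / 2 ≤ Real.exp s := by
    have := Real.quadratic_le_exp_of_nonneg hs0
    linarith
  calc ‖diniEntire ν w‖ ≤ ‖besselEntire ν w‖ + ‖w / 2 * besselEntire (ν + 1) w‖ := norm_sub_le _ _
    _ ≤ C₀ * Real.exp (k₀ * s) + Real.exp s * (C₁ * Real.exp (k₁ * s)) := by
      rw [norm_mul, hsq]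
      gcongr
      · exact h₀ w
      · exact h₁ w
    _ = C₀ * Real.exp (k₀ * s) + C₁ * Real.exp ((k₁ + 1) * s) := by
      rw [add_mul, Real.exp_add, one_mul]; ring
    _ ≤ C₀ * Real.exp ((k₀ + k₁ + 1) * s) + C₁ * Real.exp ((k₀ + k₁ + 1) * s) := by
      gcongr <;> linarith
    _ = _ := by ring

/-- A function with nonnegative derivative whose boundary values force it to be constant. -/
theorem deriv_eq_zero_of_nonneg_of_boundary {F F' : ℝ → ℝ} {b : ℝ} (hc : Continuous F)
    (hF : ∀ t ∈ Ioo 0 b, HasDerivAt F (F' t) t) (hn : ∀ t ∈ Ioo 0 b, 0 ≤ F' t)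
    (h0 : F 0 = 0) (hb : F b ≤ 0) {t : ℝ} (ht : t ∈ Ioo 0 b) : F' t = 0 := by
  have hmono : MonotoneOn F (Icc 0 b) := by
    refine monotoneOn_of_deriv_nonneg (convex_Icc 0 b) hc.continuousOn ?_ ?_
    · rw [interior_Icc]
      exact fun s hs => (hF s hs).differentiableAt.differentiableWithinAt
    · rw [interior_Icc]
      intro s hs
      rw [(hF s hs).deriv]
      exact hn s hs
  have hb0 : 0 ≤ b := (ht.1.trans ht.2).le
  have hzero : F =ᶠ[nhds t] fun _ => (0 : ℝ) := by
    filter_upwards [Ioo_mem_nhds ht.1 ht.2] with s hs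
    have h1 := hmono (left_mem_Icc.mpr hb0) (Ioo_subset_Icc_self hs) hs.1.le
    have h2 := hmono (Ioo_subset_Icc_self hs) (right_mem_Icc.mpr hb0) hs.2.le
    linarith
  rw [← (hF t ht).deriv, hzero.deriv_eq, deriv_const]

theorem not_forall_besselEntire_eq_zero {ν : ℝ} (hν : -1 < ν) (l : ℂ) {b : ℝ} (hb : 0 < b) :
    ¬ ∀ t ∈ Ioo 0 b, besselEntire ν (l * (t : ℝ)) = 0 := by
  intro h
  have hc : Continuous fun t : ℝ => besselEntire ν (l * t) :=
    (differentiable_besselEntire hν).continuous.comp (by fun_prop)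
  have h1 : Tendsto (fun t : ℝ => besselEntire ν (l * t)) (nhdsWithin 0 (Ioi 0))
      (nhds (besselEntire ν 0)) := by
    have := hc.tendsto 0
    simp only [Complex.ofReal_zero, mul_zero] at this
    exact this.mono_left nhdsWithin_le_nhds
  have h2 : Tendsto (fun t : ℝ => besselEntire ν (l * t)) (nhdsWithin 0 (Ioi 0)) (nhds 0) := by
    refine tendsto_const_nhds.congr' ?_
    filter_upwards [Ioo_mem_nhdsGT hb] with t ht
    exact (h t ht).symm
  exact besselEntire_zero_ne hν (tendsto_nhds_unique h1 h2)

theorem exists_rotation {l : ℂ} (h0 : l ≠ 0) (h : ¬ (l.im = 0 ∧ 0 < l.re)) :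
    ∃ s : ℂ, 0 ≤ s.re ∧ (s * l).re < 0 := by
  by_cases him : l.im = 0
  · refine ⟨1, by simp, ?_⟩
    have h1 : l.re ≠ 0 := fun hre => h0 (Complex.ext hre him)
    have h2 : ¬ 0 < l.re := fun hre => h ⟨him, hre⟩
    rw [one_mul]
    exact lt_of_le_of_ne (not_lt.mp h2) h1
  · refine ⟨l.im * Complex.I, by simp, ?_⟩
    have : 0 < l.im * l.im := mul_self_pos.mpr him
    simpa using this

/-- All zeros of `D_ν` are real and positive. -/
theorem im_eq_zero_and_re_pos_of_diniEntire_eq_zero {ν : ℝ} (hν : -1 < ν) {l : ℂ}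
    (hl : diniEntire ν l = 0) : l.im = 0 ∧ 0 < l.re := by
  by_contra hcon
  have hl0 : l ≠ 0 := by
    rintro rfl
    exact diniEntire_zero_ne hν hl
  obtain ⟨s, hs, hsl⟩ := exists_rotation hl0 hcon
  have hν' : 0 < ν + 1 := by linarith
  let u : ℝ → ℂ := fun t => besselEntire ν (l * t)
  let p : ℝ → ℂ := fun t => -1 / 4 * besselEntire (ν + 1) (l * t)
  let F : ℝ → ℝ := fun t => t ^ (ν + 1) * (s * (star (u t) * (l * p t))).re
  let F' : ℝ → ℝ := fun t => t ^ (ν + 1) * (s.re * Complex.normSq (l * p t))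
    - (s * l).re / 4 * (t ^ ν * Complex.normSq (u t))
  have hc0 : Continuous u := (differentiable_besselEntire hν).continuous.comp (by fun_prop)
  have hc1 : Continuous p :=
    ((differentiable_besselEntire (by linarith : -1 < ν + 1)).continuous.comp
      (by fun_prop : Continuous fun t : ℝ => l * t)).const_smul (-1 / 4 : ℂ)
  have hFc : Continuous F := by
    have h1 : Continuous fun t : ℝ => t ^ (ν + 1) :=
      Real.continuous_rpow_const hν'.le
    exact h1.mul (Complex.continuous_re.comp (continuous_const.mul
      (hc0.star.mul (continuous_const.mul hc1))))
  have hlin : ∀ t : ℝ, HasDerivAt (fun t : ℝ => l * t) l t := fun t => by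
    simpa using (Complex.ofRealCLM.hasDerivAt (x := t)).const_mul l
  have hF : ∀ t ∈ Ioo (0 : ℝ) 1, HasDerivAt F (F' t) t := by
    intro t ht
    have hu : HasDerivAt u (p t * l) t := by
      have := (hasDerivAt_besselEntire hν (l * t)).comp t (hlin t)
      exact this
    have hp : HasDerivAt p (-1 / 4 * (-1 / 4 * besselEntire (ν + 2) (l * t) * l)) t := by
      have := (hasDerivAt_besselEntire (by linarith : -1 < ν + 1) (l * t)).comp t (hlin t)
      rw [show ν + 1 + 1 = ν + 2 by ring] at this
      exact this.const_mul _
    have hre := (Complex.reCLM.hasFDerivAt.comp_hasDerivAt t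
      ((hu.star.mul (hp.const_mul l)).const_mul s))
    have hpow : HasDerivAt (fun t : ℝ => t ^ (ν + 1)) ((ν + 1) * t ^ ν) t := by
      simpa using Real.hasDerivAt_rpow_const (x := t) (p := ν + 1) (Or.inl ht.1.ne')
    refine (hpow.mul hre).congr_deriv ?_
    have hrec : (t : ℂ) * (-1 / 4 * (-1 / 4 * besselEntire (ν + 2) (l * t) * l))
        = -(ν + 1) * p t - u t / 4 := by
      simp only [p, u, besselEntire_recurrence hν (l * t)]
      ring
    set p' := -1 / 4 * (-1 / 4 * besselEntire (ν + 2) (l * t) * l)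
    have hp1 : t ^ (ν + 1) = t ^ ν * t := by rw [Real.rpow_add ht.1, Real.rpow_one]
    simp only [F', hp1, Complex.reCLM_apply, Function.comp]
    have hcomb : ((ν + 1 : ℝ) : ℂ) * (s * (star (u t) * (l * p t)))
        + (t : ℂ) * (s * (star (p t * l) * (l * p t) + star (u t) * (l * p')))
        = (t : ℂ) * (s * (Complex.normSq (l * p t) : ℂ))
          - s * l / 4 * (Complex.normSq (u t) : ℂ) := by
      rw [Complex.normSq_eq_conj_mul_self, Complex.normSq_eq_conj_mul_self]
      simp only [starRingEnd_apply, mul_comm (p t) l]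
      push_cast
      linear_combination s * star (u t) * l * hrec
    have hcombre := congrArg Complex.re hcomb
    rw [Complex.add_re, Complex.sub_re, Complex.re_ofReal_mul, Complex.re_ofReal_mul,
      Complex.re_ofReal_mul, Complex.re_mul_ofReal, Complex.re_mul_ofReal,
      show s * l / 4 = s * l / ((4 : ℝ) : ℂ) by norm_num, Complex.div_ofReal_re] at hcombre
    linear_combination t ^ ν * hcombre
  have hterm : ∀ t ∈ Ioo (0 : ℝ) 1, 0 ≤ t ^ (ν + 1) * (s.re * Complex.normSq (l * p t)) ∧
      0 ≤ -(s * l).re / 4 * (t ^ ν * Complex.normSq (u t)) := fun t ht =>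
    ⟨mul_nonneg (Real.rpow_nonneg ht.1.le _) (mul_nonneg hs (Complex.normSq_nonneg _)),
      mul_nonneg (by linarith) (mul_nonneg (Real.rpow_nonneg ht.1.le _) (Complex.normSq_nonneg _))⟩
  have hF0 : F 0 = 0 := by simp [F, Real.zero_rpow hν'.ne']
  have hF1 : F 1 ≤ 0 := by
    have h1 : l * p 1 = -(1 / 2 : ℝ) * u 1 := by
      simp only [p, u, Complex.ofReal_one, mul_one]
      rw [diniEntire] at hl
      push_cast
      linear_combination (1 / 2 : ℂ) * hl
    have h2 : s * (star (u 1) * (l * p 1)) = s * ((-(1 / 2) * Complex.normSq (u 1) : ℝ) : ℂ) := by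
      rw [h1]
      push_cast
      rw [Complex.normSq_eq_conj_mul_self, starRingEnd_apply]
      ring
    simp only [F, Real.one_rpow, one_mul]
    rw [h2, Complex.re_mul_ofReal]
    have := mul_nonneg hs (Complex.normSq_nonneg (u 1))
    linarith
  refine not_forall_besselEntire_eq_zero hν l one_pos fun t ht => ?_
  have hz := deriv_eq_zero_of_nonneg_of_boundary hFc hF
    (fun t ht => by have := hterm t ht; simp only [F']; linarith) hF0 hF1 ht
  have h1 := hterm t ht
  simp only [F'] at hz
  have h2 : -(s * l).re / 4 * (t ^ ν * Complex.normSq (u t)) = 0 := by linarith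
  have h3 : -(s * l).re / 4 ≠ 0 := by linarith
  have h4 := (mul_eq_zero.mp ((mul_eq_zero.mp h2).resolve_left h3)).resolve_left
    (Real.rpow_pos_of_pos ht.1 ν).ne'
  exact Complex.normSq_eq_zero.mp h4

/-- All zeros of `D_ν` are simple. -/
theorem deriv_diniEntire_ne_zero {ν : ℝ} (hν : -1 < ν) {x : ℝ} (hx : 0 < x)
    (hl : diniEntire ν x = 0) : deriv (diniEntire ν) x ≠ 0 := by
  intro hd
  rw [(hasDerivAt_diniEntire hν x).deriv] at hd
  have hν' : 0 < ν + 1 := by linarith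
  let e : ℝ → ℝ → ℝ := fun μ t => (besselEntire μ t).re
  have he : ∀ μ, -1 < μ → ∀ t, HasDerivAt (e μ) (-1 / 4 * e (μ + 1) t) t := by
    intro μ hμ t
    refine (hasDerivAt_besselEntire hμ (t : ℂ)).real_of_complex.congr_deriv ?_
    rw [show (-1 / 4 : ℂ) = ((-1 / 4 : ℝ) : ℂ) by push_cast; ring, Complex.re_ofReal_mul]
  have hrec : ∀ t : ℝ, e ν t = (ν + 1) * e (ν + 1) t - t / 4 * e (ν + 2) t := by
    intro t
    have h := besselEntire_recurrence hν (t : ℂ)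
    rw [← ofReal_re_besselEntire, ← ofReal_re_besselEntire (ν + 1), ← ofReal_re_besselEntire (ν + 2)] at h
    exact_mod_cast h
  have hl' : e ν x - x / 2 * e (ν + 1) x = 0 := by
    rw [diniEntire, ← ofReal_re_besselEntire, ← ofReal_re_besselEntire (ν + 1)] at hl
    exact_mod_cast hl
  have hd' : -3 / 4 * e (ν + 1) x + x / 8 * e (ν + 2) x = 0 := by
    rw [← ofReal_re_besselEntire, ← ofReal_re_besselEntire (ν + 2)] at hd
    exact_mod_cast hd
  let F : ℝ → ℝ := fun t => t ^ (ν + 1) *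
    (e ν t ^ 2 / 4 + t * e (ν + 1) t ^ 2 / 16 - ν * (e ν t * e (ν + 1) t) / 4)
  have hc : ∀ μ, -1 < μ → Continuous (e μ) := fun μ hμ =>
    continuous_iff_continuousAt.mpr fun t => (he μ hμ t).continuousAt
  have hFc : Continuous F := by
    have h1 : Continuous fun t : ℝ => t ^ (ν + 1) := Real.continuous_rpow_const hν'.le
    have h2 := hc ν hν
    have h3 := hc (ν + 1) (by linarith)
    fun_prop
  have hF : ∀ t ∈ Ioo (0 : ℝ) x, HasDerivAt F (t ^ ν * (e ν t ^ 2 / 4)) t := by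
    intro t ht
    have h0 := he ν hν t
    have h1 := he (ν + 1) (by linarith) t
    rw [show ν + 1 + 1 = ν + 2 by ring] at h1
    have hpow : HasDerivAt (fun t : ℝ => t ^ (ν + 1)) ((ν + 1) * t ^ ν) t := by
      simpa using Real.hasDerivAt_rpow_const (x := t) (p := ν + 1) (Or.inl ht.1.ne')
    refine (hpow.mul (((((h0.pow 2).div_const 4).add
      (((hasDerivAt_id' t).mul (h1.pow 2)).div_const 16)).sub
      (((h0.mul h1).const_mul ν).div_const 4)))).congr_deriv ?_
    have hp1 : t ^ (ν + 1) = t ^ ν * t := by rw [Real.rpow_add ht.1, Real.rpow_one]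
    simp only [hp1, Pi.add_apply, Pi.sub_apply, Pi.mul_apply, Pi.pow_apply]
    have hr := hrec t
    push_cast
    linear_combination t ^ ν * (ν * e ν t / 4 - t * e (ν + 1) t / 8) * hr
  have hFx : F x = 0 := by
    have hr := hrec x
    have h1 : e (ν + 1) x * (2 * ν - 1 - x) = 0 := by
      linear_combination 4 * hd' - 2 * hr + 2 * hl'
    have h2 : e ν x ^ 2 / 4 + x * e (ν + 1) x ^ 2 / 16 - ν * (e ν x * e (ν + 1) x) / 4 = 0 := by
      rw [sub_eq_zero.mp hl']
      linear_combination -x / 16 * e (ν + 1) x * h1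
    simp only [F, h2, mul_zero]
  refine not_forall_besselEntire_eq_zero hν 1 hx fun t ht => ?_
  have hz := deriv_eq_zero_of_nonneg_of_boundary hFc hF
    (fun t ht => mul_nonneg (Real.rpow_nonneg ht.1.le _) (by positivity))
    (by simp [F, Real.zero_rpow hν'.ne']) hFx.le ht
  have h1 := (mul_eq_zero.mp hz).resolve_left (Real.rpow_pos_of_pos ht.1 ν).ne'
  have h2 : e ν t = 0 := by
    have : e ν t ^ 2 = 0 := by linarith
    exact pow_eq_zero_iff two_ne_zero |>.mp this
  rw [one_mul, ← ofReal_re_besselEntire]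
  exact_mod_cast h2


/-- Finitely many simple zeros of an entire function can be divided out. -/
theorem exists_eq_prod_mul_of_zeros {h : ℂ → ℂ} (hd : Differentiable ℂ h) {a : ℕ → ℂ}
    (ha : Function.Injective a) (ha0 : ∀ n, a n ≠ 0) (hz : ∀ n, h (a n) = 0) (N : ℕ) :
    ∃ q : ℂ → ℂ, Differentiable ℂ q ∧ ∀ w, h w = (∏ n ∈ Finset.range N, (1 - w / a n)) * q w := by
  induction N with
  | zero => exact ⟨h, hd, by simp⟩
  | succ N ih =>
    obtain ⟨q, hq, hqe⟩ := ih
    have hP : ∏ n ∈ Finset.range N, (1 - a N / a n) ≠ 0 := by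
      refine Finset.prod_ne_zero_iff.mpr fun n hn hc => ?_
      have h1 : a N = a n := ((div_eq_one_iff_eq (ha0 n)).mp (sub_eq_zero.mp hc).symm)
      exact (Finset.mem_range.mp hn).ne' (ha h1)
    have hqN : q (a N) = 0 := by
      have := hqe (a N)
      rw [hz N] at this
      exact (mul_eq_zero.mp this.symm).resolve_left hP
    refine ⟨fun w => -a N * dslope q (a N) w, ?_, fun w => ?_⟩
    · have : Differentiable ℂ (dslope q (a N)) := by
        rw [← differentiableOn_univ]
        exact (Complex.differentiableOn_dslope univ_mem).mpr hq.differentiableOn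
      exact this.const_mul _
    · have h1 : (w - a N) * dslope q (a N) w = q w := by
        have := sub_smul_dslope q (a N) w
        simpa [hqN] using this
      have h2 : (1 - w / a N) * (-a N) = w - a N := by
        have := ha0 N
        field_simp
        ring
      rw [hqe w, Finset.prod_range_succ, ← h1, ← h2]
      ring

/-- After dividing out simple zeros, the quotient does not vanish at those zeros. -/
theorem ne_zero_of_eq_prod_mul {h q : ℂ → ℂ} {a : ℕ → ℂ} {N : ℕ} (hq : Differentiable ℂ q)
    (ha0 : ∀ n, a n ≠ 0)
    (hqe : ∀ w, h w = (∏ n ∈ Finset.range N, (1 - w / a n)) * q w) {m : ℕ} (hm : m < N)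
    (hs : deriv h (a m) ≠ 0) : q (a m) ≠ 0 := by
  intro hc
  apply hs
  have hP : DifferentiableAt ℂ (fun w => ∏ n ∈ Finset.range N, (1 - w / a n)) (a m) := by
    fun_prop
  have he : h = fun w => (∏ n ∈ Finset.range N, (1 - w / a n)) * q w := funext hqe
  have hP0 : ∏ n ∈ Finset.range N, (1 - a m / a n) = 0 :=
    Finset.prod_eq_zero (Finset.mem_range.mpr hm) (by simp [ha0 m])
  rw [he, deriv_fun_mul hP (hq _), hc, hP0]
  simp

/-- A zero-free holomorphic function on a ball is, up to a constant, the exponential of a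
holomorphic function vanishing at the centre. -/
theorem exists_eq_mul_exp_on_ball {q : ℂ → ℂ} {R : ℝ} (hR : 0 < R)
    (hq : DifferentiableOn ℂ q (Metric.ball 0 R)) (hq0 : ∀ w ∈ Metric.ball (0 : ℂ) R, q w ≠ 0) :
    ∃ L : ℂ → ℂ, DifferentiableOn ℂ L (Metric.ball 0 R) ∧ L 0 = 0 ∧
      ∀ w ∈ Metric.ball (0 : ℂ) R, q w = q 0 * Complex.exp (L w) := by
  have hq' : DifferentiableOn ℂ (fun w => deriv q w / q w) (Metric.ball 0 R) :=
    (hq.deriv Metric.isOpen_ball).div hq hq0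
  obtain ⟨L, hL0, hL⟩ := hq'.isExactOn_ball.with_val_at 0 0
  have h0 : (0 : ℂ) ∈ Metric.ball (0 : ℂ) R := Metric.mem_ball_self hR
  refine ⟨L, fun w hw => (hL w hw).differentiableAt.differentiableWithinAt, hL0, fun w hw => ?_⟩
  have hE : ∀ w ∈ Metric.ball (0 : ℂ) R,
      HasDerivAt (fun w => q w * Complex.exp (-L w)) 0 w := by
    intro w hw
    have h1 : HasDerivAt q (deriv q w) w :=
      ((hq w hw).differentiableAt (Metric.isOpen_ball.mem_nhds hw)).hasDerivAt
    have h2 := (hL w hw).neg.cexp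
    refine (h1.mul h2).congr_deriv ?_
    have := hq0 w hw
    simp only [Pi.neg_apply]
    field_simp
    ring
  have hc : q w * Complex.exp (-L w) = q 0 * Complex.exp (-L 0) :=
    (convex_ball (0 : ℂ) R).is_const_of_fderivWithin_eq_zero (𝕜 := ℂ)
      (f := fun w => q w * Complex.exp (-L w))
      (fun z hz => (hE z hz).differentiableAt.differentiableWithinAt)
      (fun z hz => by
        rw [fderivWithin_of_isOpen Metric.isOpen_ball hz]
        have := (hE z hz).hasFDerivAt.fderiv
        rw [this]; ext; simp) hw h0
  rw [hL0, neg_zero, Complex.exp_zero, mul_one] at hc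
  rw [← hc, mul_assoc, ← Complex.exp_add]
  simp

/-- Quantitative form, via the Borel–Carathéodory inequality. -/
theorem exists_eq_mul_exp_norm_le {q : ℂ → ℂ} {R r M : ℝ} (hM : 0 < M) (hr : 0 < r)
    (hrR : 2 * r ≤ R) (hq : DifferentiableOn ℂ q (Metric.ball 0 R))
    (hq0 : ∀ w ∈ Metric.ball (0 : ℂ) R, q w ≠ 0)
    (hB : ∀ w ∈ Metric.ball (0 : ℂ) R, ‖q w‖ ≤ ‖q 0‖ * Real.exp M) {w : ℂ} (hw : ‖w‖ ≤ r) :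
    ∃ l : ℂ, q w = q 0 * Complex.exp l ∧ ‖l‖ ≤ 4 * r * (M / R) := by
  have hR : 0 < R := by linarith
  obtain ⟨L, hLd, hL0, hL⟩ := exists_eq_mul_exp_on_ball hR hq hq0
  have hwR : w ∈ Metric.ball (0 : ℂ) R := by
    rw [mem_ball_zero_iff]; linarith
  refine ⟨L w, hL w hwR, ?_⟩
  have hmaps : MapsTo L (Metric.ball 0 R) {z | z.re ≤ M} := by
    intro z hz
    have h1 := hB z hz
    have h0 : 0 < ‖q 0‖ := norm_pos_iff.mpr (hq0 0 (Metric.mem_ball_self hR))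
    rw [hL z hz, norm_mul, Complex.norm_exp] at h1
    exact Real.exp_le_exp.mp (le_of_mul_le_mul_left h1 h0)
  refine (Complex.borelCaratheodory_zero hM hLd hmaps hR hwR hL0).trans ?_
  have h2 : R / 2 ≤ R - ‖w‖ := by linarith
  calc 2 * M * ‖w‖ / (R - ‖w‖) ≤ 2 * M * r / (R / 2) := by gcongr
    _ = 4 * r * (M / R) := by field_simp; ring

/-- Hadamard factorization for an entire function of order at most `1/2` with simple zeros. -/
theorem tendstoLocallyUniformlyOn_prod_of_growth {h : ℂ → ℂ} (hd : Differentiable ℂ h)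
    (h0 : h 0 ≠ 0) {a : ℕ → ℂ} (ha : Function.Injective a) (hmono : Monotone fun n => ‖a n‖)
    (htop : Tendsto (fun n => ‖a n‖) atTop atTop)
    (hz : ∀ w, h w = 0 ↔ ∃ n, a n = w) (hs : ∀ n, deriv h (a n) ≠ 0) {C c : ℝ} (hc : 0 ≤ c)
    (hgrowth : ∀ w, ‖h w‖ ≤ C * Real.exp (c * √‖w‖)) :
    TendstoLocallyUniformlyOn (fun N w => h 0 * ∏ n ∈ Finset.range N, (1 - w / a n)) h
      atTop univ := by
  have ha0 : ∀ n, a n ≠ 0 := fun n hn => h0 ((hz 0).mpr ⟨n, hn⟩)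
  have hn0 : 0 < ‖h 0‖ := norm_pos_iff.mpr h0
  have hC : ‖h 0‖ ≤ C := by simpa using hgrowth 0
  have hC0 : 0 < C := hn0.trans_le hC
  set K := Real.log (C / ‖h 0‖) + 1 with hK
  have hK1 : 1 ≤ K := by
    have := Real.log_nonneg ((one_le_div hn0).mpr hC)
    linarith
  let M : ℝ → ℝ := fun R => K + c * √(2 * R)
  have hMR : Tendsto (fun R => M R / R) atTop (nhds 0) := by
    have h1 : Tendsto (fun R : ℝ => K / R + c * √2 / √R) atTop (nhds (0 + 0)) :=
      (tendsto_const_nhds.div_atTop tendsto_id).add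
        (tendsto_const_nhds.div_atTop Real.tendsto_sqrt_atTop)
    rw [add_zero] at h1
    refine h1.congr' ?_
    filter_upwards [eventually_gt_atTop 0] with R hR
    have h2 : √R * √R = R := Real.mul_self_sqrt hR.le
    have h3 : √R ≠ 0 := (Real.sqrt_pos.mpr hR).ne'
    simp only [M, add_div, Real.sqrt_mul (zero_le_two : (0 : ℝ) ≤ 2)]
    congr 1
    rw [div_eq_div_iff h3 hR.ne']
    linear_combination (-c * √2) * h2
  -- the key bound on the logarithm of the quotient
  have key : ∀ N (r : ℝ), 0 < r → 2 * r ≤ ‖a N‖ → ∀ w : ℂ, ‖w‖ ≤ r →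
      ∃ l : ℂ, h w = (∏ n ∈ Finset.range N, (1 - w / a n)) * (h 0 * Complex.exp l) ∧
        ‖l‖ ≤ 4 * r * (M ‖a N‖ / ‖a N‖) := by
    intro N r hr hrN w hw
    obtain ⟨q, hq, hqe⟩ := exists_eq_prod_mul_of_zeros hd ha ha0 (fun n => (hz _).mpr ⟨n, rfl⟩) N
    have hq00 : q 0 = h 0 := by simp [hqe 0]
    set R := ‖a N‖ with hR
    have hRpos : 0 < R := norm_pos_iff.mpr (ha0 N)
    have hqne : ∀ w ∈ Metric.ball (0 : ℂ) R, q w ≠ 0 := by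
      intro w hw hqw
      obtain ⟨m, rfl⟩ := (hz w).mp (by rw [hqe, hqw, mul_zero])
      rcases lt_or_ge m N with hm | hm
      · exact ne_zero_of_eq_prod_mul hq ha0 hqe hm (hs m) hqw
      · exact absurd (mem_ball_zero_iff.mp hw) (not_lt.mpr (hmono hm))
    have hexp : ‖q 0‖ * Real.exp (M R) = Real.exp 1 * (C * Real.exp (c * √(2 * R))) := by
      simp only [M, hK, hq00, Real.exp_add, Real.exp_log (div_pos hC0 hn0)]
      field_simp
    have hqB : ∀ w ∈ Metric.ball (0 : ℂ) R, ‖q w‖ ≤ ‖q 0‖ * Real.exp (M R) := by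
      intro w hw
      refine Complex.norm_le_of_forall_mem_frontier_norm_le (U := Metric.ball (0 : ℂ) (2 * R))
        Metric.isBounded_ball hq.diffContOnCl ?_
        (subset_closure (Metric.ball_subset_ball (by linarith) hw))
      intro z hzz
      rw [frontier_ball _ (by positivity), mem_sphere_zero_iff_norm] at hzz
      have hP : 1 ≤ ‖∏ n ∈ Finset.range N, (1 - z / a n)‖ := by
        rw [norm_prod]
        refine Finset.one_le_prod fun n hn => ?_
        have h1 : ‖a n‖ ≤ R := hmono (Finset.mem_range.mp hn).le
        have h2 : 2 ≤ ‖z / a n‖ := by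
          rw [norm_div, hzz, le_div_iff₀ (norm_pos_iff.mpr (ha0 n))]
          linarith
        have h3 := norm_sub_norm_le (z / a n) 1
        rw [norm_sub_rev, norm_one] at h3
        linarith
      have h1 := hgrowth z
      rw [hqe z, norm_mul, hzz] at h1
      have h2 : 1 ≤ Real.exp 1 := Real.one_le_exp zero_le_one
      have h3 : 0 < C * Real.exp (c * √(2 * R)) := by positivity
      rw [hexp]
      nlinarith [norm_nonneg (q z)]
    have hMpos : 0 < M R := by positivity
    obtain ⟨l, hl, hl'⟩ := exists_eq_mul_exp_norm_le hMpos hr hrN hq.differentiableOn hqne hqB hw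
    exact ⟨l, by rw [hqe w, hl, hq00], hl'⟩
  rw [tendstoLocallyUniformlyOn_iff_forall_isCompact isOpen_univ]
  intro S _ hS
  obtain ⟨r, hr, hSr⟩ := hS.isBounded.exists_pos_norm_le
  rw [Metric.tendstoUniformlyOn_iff]
  intro ε hε
  set B := C * Real.exp (c * √r) with hB
  have hBpos : 0 < B := by positivity
  have hlim : Tendsto (fun N => 4 * r * (M ‖a N‖ / ‖a N‖)) atTop (nhds 0) := by
    simpa using (hMR.comp htop).const_mul (4 * r)
  filter_upwards [htop.eventually_ge_atTop (2 * r), hlim.eventually_lt_const zero_lt_one,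
    hlim.eventually_lt_const (show 0 < ε / (2 * B) by positivity)] with N h1 h2 h3 w hw
  obtain ⟨l, hl, hl'⟩ := key N r hr h1 w (hSr w hw)
  have hle : h 0 * ∏ n ∈ Finset.range N, (1 - w / a n) = h w * Complex.exp (-l) := by
    rw [hl, Complex.exp_neg]
    field_simp
  have hnw : ‖h w‖ ≤ B := (hgrowth w).trans (by rw [hB]; gcongr; exact hSr w hw)
  have he : ‖Complex.exp (-l) - 1‖ ≤ 2 * ‖-l‖ :=
    Complex.norm_exp_sub_one_le (by rw [norm_neg]; linarith)
  rw [hle, dist_eq_norm, show h w - h w * Complex.exp (-l) = -(h w * (Complex.exp (-l) - 1)) by ring,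
    norm_neg, norm_mul]
  rw [norm_neg] at he
  have h4 : ‖l‖ < ε / (2 * B) := hl'.trans_lt h3
  rw [lt_div_iff₀ (by positivity)] at h4
  nlinarith [norm_nonneg (h w), norm_nonneg l, norm_nonneg (Complex.exp (-l) - 1)]

theorem deriv_logDeriv_eq {f : ℂ → ℂ} (hf : Differentiable ℂ f) {z : ℂ} (hz : f z ≠ 0) :
    deriv (logDeriv f) z = deriv (deriv f) z / f z - (deriv f z / f z) ^ 2 := by
  have h1 : logDeriv f = fun w => deriv f w / f w := by ext; simp [logDeriv_apply]
  rw [h1, deriv_fun_div (hf.deriv z) (hf z) hz]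
  field_simp

/-- The second logarithmic derivative of `z ↦ h (z²)` as a limit of partial sums over zeros. -/
theorem tendsto_sum_deriv_logDeriv {h : ℂ → ℂ} (hd : Differentiable ℂ h)
    (h0 : h 0 ≠ 0) {a : ℕ → ℂ} (hz : ∀ n, h (a n) = 0)
    (hlim : TendstoLocallyUniformlyOn (fun N w => h 0 * ∏ n ∈ Finset.range N, (1 - w / a n)) h
      atTop univ) {z : ℂ} (hzz : h (z ^ 2) ≠ 0) :
    Tendsto (fun N => ∑ n ∈ Finset.range N, -2 * ((a n + z ^ 2) / (a n - z ^ 2) ^ 2)) atTop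
      (nhds (deriv (logDeriv fun w => h (w ^ 2)) z)) := by
  have ha0 : ∀ n, a n ≠ 0 := fun n hn => h0 (hn ▸ hz n)
  set G : ℕ → ℂ → ℂ := fun N w => h 0 * ∏ n ∈ Finset.range N, (1 - w ^ 2 / a n) with hG
  have hGd : ∀ N, Differentiable ℂ (G N) := fun N => by simp only [hG]; fun_prop
  have hgd : Differentiable ℂ fun w => h (w ^ 2) := by fun_prop
  have hl0 : TendstoLocallyUniformlyOn G (fun w => h (w ^ 2)) atTop univ :=
    hlim.comp (fun w => w ^ 2) (mapsTo_univ _ _) (by fun_prop)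
  have hl1 := hl0.deriv (Eventually.of_forall fun N => (hGd N).differentiableOn) isOpen_univ
  have hl2 := hl1.deriv (Eventually.of_forall fun N => (hGd N).deriv.differentiableOn) isOpen_univ
  have t0 := hl0.tendsto_at (mem_univ z)
  have t1 := hl1.tendsto_at (mem_univ z)
  have t2 := hl2.tendsto_at (mem_univ z)
  rw [deriv_logDeriv_eq hgd hzz]
  refine ((t2.div t0 hzz).sub ((t1.div t0 hzz).pow 2)).congr fun N => ?_
  have hU : IsOpen {w : ℂ | h (w ^ 2) ≠ 0} := isOpen_ne_fun hgd.continuous continuous_const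
  have hfac : ∀ w : ℂ, h (w ^ 2) ≠ 0 → ∀ n, a n - w ^ 2 ≠ 0 := by
    intro w hw n hc
    exact hw (sub_eq_zero.mp hc ▸ hz n)
  have hfac' : ∀ w : ℂ, h (w ^ 2) ≠ 0 → ∀ n, 1 - w ^ 2 / a n ≠ 0 := by
    intro w hw n
    rw [one_sub_div (ha0 n)]
    exact div_ne_zero (hfac w hw n) (ha0 n)
  have hGne : G N z ≠ 0 :=
    mul_ne_zero h0 (Finset.prod_ne_zero_iff.mpr fun n _ => hfac' z hzz n)
  change deriv (deriv (G N)) z / G N z - (deriv (G N) z / G N z) ^ 2 = _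
  rw [← deriv_logDeriv_eq (hGd N) hGne]
  have hev : logDeriv (G N) =ᶠ[nhds z]
      fun w => ∑ n ∈ Finset.range N, -2 * (w / (a n - w ^ 2)) := by
    filter_upwards [hU.mem_nhds hzz] with w hw
    simp only [hG]
    rw [logDeriv_const_mul _ _ h0, logDeriv_prod (fun n _ => hfac' w hw n) (by fun_prop)]
    refine Finset.sum_congr rfl fun n _ => ?_
    have e1 := hfac w hw n
    have e2 := ha0 n
    have hD : HasDerivAt (fun w : ℂ => 1 - w ^ 2 / a n) (-(2 * w / a n)) w := by
      simpa using ((hasDerivAt_pow 2 w).div_const (a n)).const_sub 1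
    rw [logDeriv_apply, hD.deriv, one_sub_div e2]
    field_simp
  rw [hev.deriv_eq]
  refine HasDerivAt.deriv (HasDerivAt.fun_sum fun n _ => ?_)
  have e1 := hfac z hzz n
  have hD : HasDerivAt (fun w : ℂ => a n - w ^ 2) (-(2 * z)) z := by
    simpa using (hasDerivAt_pow 2 z).const_sub (a n)
  refine (((hasDerivAt_id' z).div hD e1).const_mul (-2 : ℂ)).congr_deriv ?_
  ring

/-- If the zeros of a function that is not identically zero and entire are listed along a strictly
increasing sequence, that sequence is unbounded. -/
theorem tendsto_atTop_of_entire_zeros {g : ℂ → ℂ} (hg : Differentiable ℂ g) {z₀ : ℂ}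
    (hz₀ : g z₀ ≠ 0) {b : ℕ → ℝ} (hb : StrictMono b) (hz : ∀ n, g (b n) = 0) :
    Tendsto b atTop atTop := by
  rcases tendsto_atTop_of_monotone hb.monotone with h | ⟨l, hl⟩
  · exact h
  · exfalso
    have han : AnalyticOnNhd ℂ g univ := fun w _ => hg.analyticAt w
    have hlt : ∀ n, b n < l := fun n =>
      (hb n.lt_succ_self).trans_le (hb.monotone.ge_of_tendsto hl (n + 1))
    have ht : Tendsto (fun n => (b n : ℂ)) atTop (nhdsWithin (l : ℂ) {(l : ℂ)}ᶜ) := by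
      refine tendsto_nhdsWithin_iff.mpr ⟨(Complex.continuous_ofReal.tendsto l).comp hl, ?_⟩
      refine Eventually.of_forall fun n => ?_
      simpa using (hlt n).ne
    have hfr : ∃ᶠ w in nhdsWithin (l : ℂ) {(l : ℂ)}ᶜ, g w = 0 :=
      ht.frequently (Eventually.of_forall hz).frequently
    exact hz₀ (han.eqOn_zero_of_preconnected_of_frequently_eq_zero isPreconnected_univ
      (mem_univ _) hfr (mem_univ z₀))

theorem differentiable_diniEntire {ν : ℝ} (hν : -1 < ν) : Differentiable ℂ (diniEntire ν) :=
  fun w => (hasDerivAt_diniEntire hν w).differentiableAt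

theorem dini_eq_zero_iff {x : ℝ} (hx : 0 < x) (ν : ℝ) :
    dini ν x = 0 ↔ diniEntire ν ((x ^ 2 : ℝ) : ℂ) = 0 := by
  rw [dini_eq hx, mul_eq_zero, ← ofReal_re_diniEntire, Complex.ofReal_eq_zero]
  exact or_iff_right (Real.rpow_pos_of_pos (by positivity) ν).ne'

theorem deriv_dini_div_sub_eq {ν : ℝ} (hν : -1 < ν) {t : ℝ} (ht : 0 < t) (hd : dini ν t ≠ 0) :
    deriv (dini ν) t / dini ν t - ν / t
      = (logDeriv (fun w : ℂ => diniEntire ν (w ^ 2)) (t : ℂ)).re := by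
  have hg : Differentiable ℂ fun w : ℂ => diniEntire ν (w ^ 2) :=
    (differentiable_diniEntire hν).comp (differentiable_pow 2)
  have hre : ∀ s : ℝ, (((diniEntire ν ((s : ℂ) ^ 2)).re : ℝ) : ℂ) = diniEntire ν ((s : ℂ) ^ 2) := by
    intro s
    have := ofReal_re_diniEntire ν (s ^ 2)
    rwa [Complex.ofReal_pow] at this
  have hG := (hg (t : ℂ)).hasDerivAt.real_of_complex
  have hev : dini ν =ᶠ[nhds t] fun s => (s / 2) ^ ν * (diniEntire ν ((s : ℂ) ^ 2)).re := by
    filter_upwards [lt_mem_nhds ht] with s hs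
    rw [dini_eq hs, Complex.ofReal_pow]
  have hpow : HasDerivAt (fun s : ℝ => (s / 2) ^ ν) (ν / t * (t / 2) ^ ν) t := by
    refine (((hasDerivAt_id' t).div_const 2).rpow_const
      (Or.inl (by positivity : t / 2 ≠ 0))).congr_deriv ?_
    rw [Real.rpow_sub_one (by positivity)]
    field_simp
  have hp := Real.rpow_pos_of_pos (by positivity : 0 < t / 2) ν
  rw [hev.deriv_eq, (hpow.fun_mul hG).deriv, hev.eq_of_nhds]
  rw [hev.eq_of_nhds] at hd
  have hG0 := right_ne_zero_of_mul hd
  have hlog : (logDeriv (fun w : ℂ => diniEntire ν (w ^ 2)) (t : ℂ)).re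
      = (deriv (fun w : ℂ => diniEntire ν (w ^ 2)) (t : ℂ)).re / (diniEntire ν ((t : ℂ) ^ 2)).re := by
    rw [← Complex.div_ofReal_re, hre t, logDeriv_apply]
  rw [hlog]
  field_simp
  ring

theorem hasSum_deriv_dini {ν : ℝ} (hν : -1 < ν) {α : ℕ → ℝ} (hα0 : α 0 = 0) (hmono : StrictMono α)
    (hzeros : ∀ x : ℝ, (0 < x ∧ dini ν x = 0) ↔ ∃ n, 1 ≤ n ∧ α n = x) {x : ℝ} (hx : 0 < x)
    (hdx : dini ν x ≠ 0) :
    HasSum (fun n => ((α (n + 1)) ^ 2 + x ^ 2) / ((α (n + 1)) ^ 2 - x ^ 2) ^ 2)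
      (-(deriv (fun t : ℝ => deriv (dini ν) t / dini ν t - ν / t) x) / 2) := by
  have hd : Differentiable ℂ (diniEntire ν) := differentiable_diniEntire hν
  have h0 := diniEntire_zero_ne hν
  have hpos : ∀ n, 0 < α (n + 1) := fun n => hα0 ▸ hmono n.succ_pos
  have hsq : StrictMono fun n => α (n + 1) ^ 2 := fun m n hmn =>
    pow_lt_pow_left₀ (hmono (Nat.succ_lt_succ hmn)) (hpos m).le two_ne_zero
  set a : ℕ → ℂ := fun n => ((α (n + 1) ^ 2 : ℝ) : ℂ) with ha
  have hnorm : ∀ n, ‖a n‖ = α (n + 1) ^ 2 := fun n => by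
    rw [ha, Complex.norm_real, Real.norm_of_nonneg (sq_nonneg _)]
  have hza : ∀ n, diniEntire ν (a n) = 0 := fun n =>
    (dini_eq_zero_iff (hpos n) ν).mp ((hzeros _).mpr ⟨n + 1, by omega, rfl⟩).2
  have hz : ∀ w, diniEntire ν w = 0 ↔ ∃ n, a n = w := by
    refine fun w => ⟨fun hw => ?_, fun ⟨n, hn⟩ => hn ▸ hza n⟩
    obtain ⟨him, hre⟩ := im_eq_zero_and_re_pos_of_diniEntire_eq_zero hν hw
    have hwr : w = ((√w.re ^ 2 : ℝ) : ℂ) := by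
      rw [Real.sq_sqrt hre.le]
      exact Complex.ext rfl (by simp [him])
    have hs := Real.sqrt_pos.mpr hre
    rw [hwr] at hw
    obtain ⟨n, hn, hαn⟩ := (hzeros _).mp ⟨hs, (dini_eq_zero_iff hs ν).mpr hw⟩
    refine ⟨n - 1, ?_⟩
    simp only [ha]
    rw [hwr, ← hαn, Nat.sub_add_cancel hn]
  obtain ⟨C, c, hc, hgrowth⟩ := exists_norm_diniEntire_le hν
  have hlim := by
    refine tendstoLocallyUniformlyOn_prod_of_growth hd h0 (a := a)
      (fun m n hmn => hsq.injective (Complex.ofReal_injective hmn)) ?_ ?_ hz (fun n => ?_) hc hgrowth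
    · simpa only [hnorm] using hsq.monotone
    · simpa only [hnorm] using tendsto_atTop_of_entire_zeros hd h0 hsq hza
    · exact deriv_diniEntire_ne_zero hν (pow_pos (hpos n) 2) (hza n)
  have hdx' : diniEntire ν ((x : ℂ) ^ 2) ≠ 0 := by
    rw [← Complex.ofReal_pow]
    exact fun h => hdx ((dini_eq_zero_iff hx ν).mpr h)
  have hsum := tendsto_sum_deriv_logDeriv hd h0 hza hlim hdx'
  set g : ℂ → ℂ := fun w => diniEntire ν (w ^ 2) with hg
  have hgd : Differentiable ℂ g := hd.comp (differentiable_pow 2)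
  have hlog : DifferentiableAt ℂ (logDeriv g) (x : ℂ) :=
    (hgd.deriv (x : ℂ)).div (hgd (x : ℂ)) hdx'
  have hev : (fun t : ℝ => deriv (dini ν) t / dini ν t - ν / t)
      =ᶠ[nhds x] fun t : ℝ => (logDeriv g (t : ℂ)).re := by
    have hne : ∀ᶠ t : ℝ in nhds x, g (t : ℂ) ≠ 0 :=
      (hgd.continuous.comp Complex.continuous_ofReal).continuousAt.eventually_ne hdx'
    filter_upwards [lt_mem_nhds hx, hne] with t ht htne
    refine deriv_dini_div_sub_eq hν ht fun h => htne ?_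
    have := (dini_eq_zero_iff ht ν).mp h
    rwa [Complex.ofReal_pow] at this
  rw [hev.deriv_eq, hlog.hasDerivAt.real_of_complex.deriv]
  rw [hasSum_iff_tendsto_nat_of_nonneg (fun n => by positivity)]
  have hre := ((Complex.continuous_re.tendsto _).comp hsum).neg.div_const 2
  refine hre.congr fun N => ?_
  have hcast : ∑ n ∈ Finset.range N, -2 * ((a n + (x : ℂ) ^ 2) / (a n - (x : ℂ) ^ 2) ^ 2)
      = ((-2 * ∑ n ∈ Finset.range N,
        (α (n + 1) ^ 2 + x ^ 2) / (α (n + 1) ^ 2 - x ^ 2) ^ 2 : ℝ) : ℂ) := by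
    rw [← Finset.mul_sum]
    simp only [ha]
    push_cast
    rfl
  rw [Function.comp_apply, hcast, Complex.ofReal_re]
  ring

/-- Let `ν > -1` and let `α 1 < α 2 < ⋯` enumerate the positive zeros of
`d_ν`, with `α 0 = 0`, and set `Δ_ν = ⋃_{k ≥ 0} (α (2k), α (2k+1))`.  Then the function
`f_ν(x) = d_ν'(x) / d_ν(x) - ν / x` satisfies
`f_ν'(x) = -2 ∑_{n ≥ 1} (α_n² + x²)/(α_n² - x²)² < 0` for all `x ∈ Δ_ν`; in particular
`f_ν` is strictly decreasing on each component interval of `Δ_ν`. -/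
theorem dini_log_deriv_decreasing (ν : ℝ) (hν : -1 < ν) (α : ℕ → ℝ)
    (hα0 : α 0 = 0) (hmono : StrictMono α)
    (hzeros : ∀ x : ℝ, (0 < x ∧ dini ν x = 0) ↔ ∃ n, 1 ≤ n ∧ α n = x) :
    (∀ x ∈ ⋃ k : ℕ, Set.Ioo (α (2 * k)) (α (2 * k + 1)),
      deriv (fun t : ℝ => deriv (dini ν) t / dini ν t - ν / t) x =
        -2 * ∑' n : ℕ, ((α (n + 1)) ^ 2 + x ^ 2) / ((α (n + 1)) ^ 2 - x ^ 2) ^ 2 ∧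
      deriv (fun t : ℝ => deriv (dini ν) t / dini ν t - ν / t) x < 0) ∧
    (∀ k : ℕ, StrictAntiOn (fun t : ℝ => deriv (dini ν) t / dini ν t - ν / t)
      (Set.Ioo (α (2 * k)) (α (2 * k + 1)))) := by
  have hmain : ∀ k : ℕ, ∀ x ∈ Set.Ioo (α (2 * k)) (α (2 * k + 1)),
      deriv (fun t : ℝ => deriv (dini ν) t / dini ν t - ν / t) x =
        -2 * ∑' n : ℕ, ((α (n + 1)) ^ 2 + x ^ 2) / ((α (n + 1)) ^ 2 - x ^ 2) ^ 2 ∧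
      deriv (fun t : ℝ => deriv (dini ν) t / dini ν t - ν / t) x < 0 := by
    intro k x hx
    have hpos : ∀ n, 0 < α (n + 1) := fun n => hα0 ▸ hmono n.succ_pos
    have hx0 : 0 < x := (hα0 ▸ hmono.monotone (Nat.zero_le (2 * k)) : 0 ≤ α (2 * k)).trans_lt hx.1
    have hdx : dini ν x ≠ 0 := by
      intro h
      obtain ⟨n, -, rfl⟩ := (hzeros x).mp ⟨hx0, h⟩
      have h1 := hmono.lt_iff_lt.mp hx.1
      have h2 := hmono.lt_iff_lt.mp hx.2
      omega
    have hsum := hasSum_deriv_dini hν hα0 hmono hzeros hx0 hdx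
    have hne : α 1 ^ 2 - x ^ 2 ≠ 0 := by
      intro h
      refine hdx ?_
      rw [← (pow_left_inj₀ (hpos 0).le hx0.le two_ne_zero).mp (sub_eq_zero.mp h)]
      exact ((hzeros _).mpr ⟨1, le_rfl, rfl⟩).2
    have hlt := hsum.summable.tsum_pos (fun n => by positivity) 0
      (by have := hpos 0; simp only [zero_add]; positivity)
    rw [hsum.tsum_eq] at hlt ⊢
    constructor <;> linarith
  refine ⟨fun x hx => ?_, fun k => ?_⟩
  · obtain ⟨k, hk⟩ := mem_iUnion.mp hx
    exact hmain k x hk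
  · refine strictAntiOn_of_deriv_neg (convex_Ioo _ _) (fun x hx => ?_) fun x hx => ?_
    · exact (differentiableAt_of_deriv_ne_zero (hmain k x hx).2.ne).continuousAt.continuousWithinAt
    · rw [interior_Ioo] at hx
      exact (hmain k x hx).2
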